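/- For every δ > 0 there exists an integer h0 such that for all h ≥ h0 there exist k ≥ 1 and a (k, 2^h − 1)-coding scheme that is non-malleable with respect to the bit-wise independent tampering family F_BIT^{[2^h−1]} with exact security at most δ. (An explicit such family is obtained by composing an AMD code with the coset-coding wiretap II code derived from the binary Hamming code of length 2^h − 1.) -/

import Mathlib

/-- Binary words of length `n`. -/
abbrev Word (n : ℕ) := Fin n → Bool

/-- Statistical distance between two distributions on a finite type. -/
noncomputable def SD {Z : Type*} [Fintype Z] (X Y : PMF Z) : ℝ :=
  (1 / 2) * ∑ z, |(X z).toReal - (Y z).toReal|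

/-- Restriction of a distribution on words to the coordinates in `S`. -/
noncomputable def restrictPMF {n : ℕ} (S : Finset (Fin n)) (X : PMF (Word n)) :
    PMF ({i : Fin n // i ∈ S} → Bool) :=
  X.map (fun c j => c j.1)

/-- Correctness of a `(k,n)`-coding scheme: decoding a sampled codeword
always returns the message. -/
def Correct {k n : ℕ} (Enc : Word k → PMF (Word n))
    (Dec : Word n → Option (Word k)) : Prop :=
  ∀ (m : Word k), ∀ c ∈ (Enc m).support, Dec c = some m

/-- The tampering family `F_BIT^{[n],r,w}`: read a set `Sr` of `r` coordinates,
and based on the read values apply bit-tampering functions on a set `Sw`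
of `w` coordinates, leaving the others untouched. -/
def FBIT (n r w : ℕ) : Set (Word n → Word n) :=
  { f | ∃ (Sr Sw : Finset (Fin n)), Sr.card = r ∧ Sw.card = w ∧
      ∃ g : ({i : Fin n // i ∈ Sr} → Bool) → ({i : Fin n // i ∈ Sw} → Bool → Bool),
        ∀ (x : Word n) (i : Fin n),
          f x i = if h : i ∈ Sw then g (fun j => x j.1) ⟨i, h⟩ (x i) else x i }

/-- Outcome alphabet `{0,1}^k ∪ {⊥, same*}`: `Sum.inl m` is a message,
`Sum.inr false` is `⊥`, and `Sum.inr true` is `same*`. -/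
abbrev NMOut (k : ℕ) := Word k ⊕ Bool

/-- Patching an outcome with the real message `m`. -/
def patchOut {k : ℕ} (m : Word k) : NMOut k → Option (Word k)
  | Sum.inl m' => some m'
  | Sum.inr true => some m
  | Sum.inr false => none

/-- The distribution of `Dec(f(c))` for `c ← Enc(m)`. -/
noncomputable def TamperDist {k n : ℕ} (Enc : Word k → PMF (Word n))
    (Dec : Word n → Option (Word k)) (f : Word n → Word n) (m : Word k) :
    PMF (Option (Word k)) :=
  (Enc m).map (fun c => Dec (f c))

/-- `Patch(D, m)`: sample from `D`, replacing `same*` by `m`. -/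
noncomputable def PatchDist {k : ℕ} (D : PMF (NMOut k)) (m : Word k) :
    PMF (Option (Word k)) :=
  D.map (patchOut m)

/-- Non-malleability of `(Enc,Dec)` w.r.t. a family `F` with exact security `ε`. -/
def NonMalleable {k n : ℕ} (Enc : Word k → PMF (Word n))
    (Dec : Word n → Option (Word k)) (F : Set (Word n → Word n)) (ε : ℝ) : Prop :=
  ∀ f ∈ F, ∃ D : PMF (NMOut k), ∀ m : Word k,
    SD (TamperDist Enc Dec f m) (PatchDist D m) ≤ ε

/-- The strong tampering experiment `StrongNM_m^f`. -/
noncomputable def StrongExp {k n : ℕ} (Enc : Word k → PMF (Word n))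
    (Dec : Word n → Option (Word k)) (f : Word n → Word n) (m : Word k) :
    PMF (NMOut k) :=
  (Enc m).map (fun c =>
    if f c = c then (Sum.inr true : NMOut k)
    else
      match Dec (f c) with
      | some m' => Sum.inl m'
      | none => Sum.inr false)

/-- Strong non-malleability with exact security `ε`. -/
def StronglyNonMalleable {k n : ℕ} (Enc : Word k → PMF (Word n))
    (Dec : Word n → Option (Word k)) (F : Set (Word n → Word n)) (ε : ℝ) : Prop :=
  ∀ f ∈ F, ∀ m0 m1 : Word k,
    SD (StrongExp Enc Dec f m0) (StrongExp Enc Dec f m1) ≤ ε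

/-- The bit-wise independent tampering family `F_BIT^{[n]}`: every bit is
tampered independently by an arbitrary single-bit function. -/
def FBITfull (n : ℕ) : Set (Word n → Word n) :=
  { f | ∃ g : Fin n → Bool → Bool, ∀ (x : Word n) (i : Fin n), f x i = g i (x i) }

/-- The syndrome of a word with respect to the parity-check matrix with columns `v i`. -/
def syndrome {n : ℕ} {V : Type*} [AddCommGroup V] (v : Fin n → V) (x : Word n) : V :=
  ∑ i, if x i then v i else 0

/-- The word `x` with its `i`-th bit negated. -/
def flipBit {n : ℕ} (i : Fin n) (x : Word n) : Word n :=
  Function.update x i (!x i)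

theorem flipBit_flipBit {n : ℕ} (i : Fin n) (x : Word n) : flipBit i (flipBit i x) = x := by
  simp [flipBit]

theorem syndrome_flipBit {n : ℕ} {V : Type*} [AddCommGroup V] (hV : ∀ w : V, w + w = 0)
    (v : Fin n → V) (i : Fin n) (x : Word n) :
    syndrome v (flipBit i x) = syndrome v x + v i := by
  unfold syndrome
  rw [← Finset.add_sum_erase _ _ (Finset.mem_univ i),
    ← Finset.add_sum_erase _ (fun j => if x j then v j else 0) (Finset.mem_univ i)]
  have hrest : ∑ j ∈ Finset.univ.erase i, (if flipBit i x j then v j else 0) =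
      ∑ j ∈ Finset.univ.erase i, (if x j then v j else 0) := by
    refine Finset.sum_congr rfl fun j hj => ?_
    simp [flipBit, Finset.ne_of_mem_erase hj]
  rw [hrest]
  cases hx : x i
  · simp [flipBit, hx, add_comm]
  · simp only [flipBit, hx, Function.update_self, Bool.not_true, Bool.false_eq_true,
      if_false, if_true]
    rw [add_right_comm, hV]

/-- A function on a finite group that is invariant under translation by at least half as many
distinct nonzero elements as there are elements in the group is constant. -/
theorem eq_apply_zero_of_translation_invariant {V α : Type*} [AddCommGroup V] [Fintype V]
    (N : V → α) (T : Finset V) (hT0 : (0 : V) ∉ T) (hT : Fintype.card V ≤ 2 * T.card)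
    (hN : ∀ w ∈ T, ∀ s, N (s + w) = N s) (s : V) : N s = N 0 := by
  classical
  let W : AddSubgroup V :=
    { carrier := {w | ∀ s, N (s + w) = N s}
      zero_mem' := fun s => by rw [add_zero]
      add_mem' := fun {a b} ha hb s => by rw [← add_assoc, hb, ha]
      neg_mem' := fun {a} ha s => by rw [← ha (s + -a), neg_add_cancel_right] }
  have hsub : ((insert 0 T : Finset V) : Set V) ⊆ W := by
    intro w hw
    rcases Finset.mem_insert.1 (Finset.mem_coe.1 hw) with rfl | hw
    · exact W.zero_mem
    · exact hN w hw
  have hcard : T.card + 1 ≤ Nat.card W := by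
    rw [← Finset.card_insert_of_notMem hT0, ← Set.ncard_coe_finset]
    exact Set.ncard_le_ncard hsub (Set.toFinite _)
  have hmul := W.card_mul_index
  rw [Nat.card_eq_fintype_card (α := V)] at hmul
  have hpos : 0 < Fintype.card V := Fintype.card_pos
  have hindex : W.index = 1 := by
    have h0 : W.index ≠ 0 := fun h => by rw [h] at hmul; omega
    by_contra h1
    have h2 : 2 ≤ W.index := by omega
    nlinarith
  have hs : s ∈ W := by rw [AddSubgroup.index_eq_one.1 hindex]; trivial
  simpa using hs 0

/-- If flipping any of the bits in `T` preserves `Q` and adds the corresponding column to `σ`,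
then each value of `σ` is attained equally often on `Q`. -/
theorem card_fiber_eq {n : ℕ} {V : Type*} [AddCommGroup V] [Fintype V] [DecidableEq V]
    (v : Fin n → V) (hv : Function.Injective v) (hv0 : ∀ i, v i ≠ 0) (T : Finset (Fin n))
    (hT : Fintype.card V ≤ 2 * T.card) (Q : Word n → Prop) [DecidablePred Q] (σ : Word n → V)
    (hQ : ∀ i ∈ T, ∀ x, Q (flipBit i x) ↔ Q x)
    (hσ : ∀ i ∈ T, ∀ x, σ (flipBit i x) = σ x + v i) (s : V) :
    (Finset.univ.filter fun x => Q x ∧ σ x = s).card =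
      (Finset.univ.filter fun x => Q x ∧ σ x = 0).card := by
  refine eq_apply_zero_of_translation_invariant
    (fun s => (Finset.univ.filter fun x => Q x ∧ σ x = s).card) (T.map ⟨v, hv⟩) ?_ ?_ ?_ s
  · simp [hv0]
  · simpa using hT
  · intro w hw s
    obtain ⟨i, hi, rfl⟩ := Finset.mem_map.1 hw
    refine Finset.card_bij' (fun x _ => flipBit i x) (fun x _ => flipBit i x) ?_ ?_
      (fun x _ => flipBit_flipBit i x) (fun x _ => flipBit_flipBit i x)
    · intro x hx
      simp only [Finset.mem_filter_univ] at hx ⊢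
      refine ⟨(hQ i hi x).2 hx.1, add_right_cancel (b := v i) ?_⟩
      rw [← hσ i hi, flipBit_flipBit]
      exact hx.2
    · intro x hx
      simp only [Finset.mem_filter_univ] at hx ⊢
      exact ⟨(hQ i hi x).2 hx.1, by rw [hσ i hi, hx.2]; rfl⟩

theorem card_filter_eq_card_mul {n : ℕ} {V : Type*} [AddCommGroup V] [Fintype V] [DecidableEq V]
    (v : Fin n → V) (hv : Function.Injective v) (hv0 : ∀ i, v i ≠ 0) (T : Finset (Fin n))
    (hT : Fintype.card V ≤ 2 * T.card) (Q : Word n → Prop) [DecidablePred Q] (σ : Word n → V)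
    (hQ : ∀ i ∈ T, ∀ x, Q (flipBit i x) ↔ Q x)
    (hσ : ∀ i ∈ T, ∀ x, σ (flipBit i x) = σ x + v i) :
    (Finset.univ.filter Q).card =
      Fintype.card V * (Finset.univ.filter fun x => Q x ∧ σ x = 0).card := by
  rw [Finset.card_eq_sum_card_fiberwise (f := σ) (t := Finset.univ) (by simp)]
  simp_rw [Finset.filter_filter, card_fiber_eq v hv hv0 T hT Q σ hQ hσ]
  simp

theorem map_uniformOfFinset_apply {α β : Type*} [DecidableEq β] (s : Finset α)
    (hs : s.Nonempty) (φ : α → β) (z : β) :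
    (PMF.uniformOfFinset s hs).map φ z = ((s.filter fun x => φ x = z).card : ENNReal) / s.card := by
  classical
  rw [← PMF.toOuterMeasure_apply_singleton, PMF.toOuterMeasure_map_apply,
    PMF.toOuterMeasure_uniformOfFinset_apply]
  simp

theorem SD_self {Z : Type*} [Fintype Z] (X : PMF Z) : SD X X = 0 := by
  simp [SD]

theorem SD_pure {Z : Type*} [Fintype Z] (X : PMF Z) (z : Z) :
    SD X (PMF.pure z) = 1 - (X z).toReal := by
  classical
  have hsum : ∑ y, (X y).toReal = 1 := by
    rw [← ENNReal.toReal_sum fun y _ => X.apply_ne_top y, ← tsum_fintype (L := .unconditional Z),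
      X.tsum_coe, ENNReal.toReal_one]
  have hle : (X z).toReal ≤ 1 := by
    simpa using ENNReal.toReal_mono ENNReal.one_ne_top (X.coe_le_one z)
  rw [← Finset.add_sum_erase _ _ (Finset.mem_univ z)] at hsum
  have hrest : ∑ y ∈ Finset.univ.erase z, |(X y).toReal - (PMF.pure z y).toReal| =
      ∑ y ∈ Finset.univ.erase z, (X y).toReal := by
    refine Finset.sum_congr rfl fun y hy => ?_
    simp [PMF.pure_apply, Finset.ne_of_mem_erase hy]
  rw [SD, ← Finset.add_sum_erase _ _ (Finset.mem_univ z), hrest, PMF.pure_apply_self,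
    ENNReal.toReal_one, abs_of_nonpos (by linarith)]
  linarith

theorem word_one_eq (m : Word 1) : m = fun _ => m 0 := by
  funext i
  rw [Subsingleton.elim i 0]

/-- The decoder that outputs whether the given word has zero syndrome. -/
def syndromeDec {n : ℕ} {V : Type*} [AddCommGroup V] [DecidableEq V] (v : Fin n → V)
    (x : Word n) : Option (Word 1) :=
  some fun _ => decide (syndrome v x = 0)

/-- The words encoding the bit `b`: the linear code for `true`, its complement for `false`. -/
def codewords {n : ℕ} {V : Type*} [AddCommGroup V] [DecidableEq V] (v : Fin n → V)
    (b : Bool) : Finset (Word n) :=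
  Finset.univ.filter fun x => decide (syndrome v x = 0) = b

theorem codewords_nonempty {n : ℕ} {V : Type*} [AddCommGroup V] [DecidableEq V]
    (v : Fin n → V) (hv0 : ∀ i, v i ≠ 0) (hn : 0 < n) (b : Bool) : (codewords v b).Nonempty := by
  cases b
  · refine ⟨fun i => decide (i = ⟨0, hn⟩), ?_⟩
    rw [codewords, Finset.mem_filter_univ]
    simp [syndrome, hv0]
  · refine ⟨fun _ => false, ?_⟩
    rw [codewords, Finset.mem_filter_univ]
    simp [syndrome]

/-- The encoder that outputs a uniformly random codeword for the message bit. -/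
noncomputable def syndromeEnc {n : ℕ} {V : Type*} [AddCommGroup V] [DecidableEq V]
    (v : Fin n → V) (hne : ∀ b, (codewords v b).Nonempty) (m : Word 1) : PMF (Word n) :=
  PMF.uniformOfFinset (codewords v (m 0)) (hne (m 0))

theorem correct_syndromeEnc {n : ℕ} {V : Type*} [AddCommGroup V] [DecidableEq V]
    (v : Fin n → V) (hne : ∀ b, (codewords v b).Nonempty) :
    Correct (syndromeEnc v hne) (syndromeDec v) := by
  intro m c hc
  have hc' : decide (syndrome v c = 0) = m 0 := by
    simpa [syndromeEnc, codewords] using hc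
  rw [syndromeDec, hc', ← word_one_eq]

/-- A bitwise tampering function that hides at least half of the columns produces an outcome
that does not depend on the message. -/
theorem TamperDist_eq_of_hidden {n : ℕ} {V : Type*} [AddCommGroup V] [Fintype V] [DecidableEq V]
    (hV : ∀ w : V, w + w = 0) (hcard : 2 ≤ Fintype.card V)
    (v : Fin n → V) (hv : Function.Injective v) (hv0 : ∀ i, v i ≠ 0)
    (hne : ∀ b, (codewords v b).Nonempty) (f : Word n → Word n) (T : Finset (Fin n))
    (hT : Fintype.card V ≤ 2 * T.card) (hf : ∀ i ∈ T, ∀ x, f (flipBit i x) = f x) (m : Word 1) :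
    TamperDist (syndromeEnc v hne) (syndromeDec v) f m =
      TamperDist (syndromeEnc v hne) (syndromeDec v) f (fun _ => true) := by
  rcases hm : m 0 with _ | _
  swap
  · rw [word_one_eq m, hm]
  have hcount : ∀ (Q : Word n → Prop) [DecidablePred Q],
      (∀ i ∈ T, ∀ x, Q (flipBit i x) ↔ Q x) →
      ((codewords v false).filter Q).card =
        (Fintype.card V - 1) * ((codewords v true).filter Q).card := by
    intro Q _ hQ
    have h1 := card_filter_eq_card_mul v hv hv0 T hT Q (syndrome v) hQ
      fun i _ x => syndrome_flipBit hV v i x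
    have h2 := Finset.card_filter_add_card_filter_not (s := Finset.univ.filter Q)
      (fun x => syndrome v x = 0)
    have h3 : (codewords v false).filter Q =
        (Finset.univ.filter Q).filter fun x => ¬ syndrome v x = 0 := by
      ext x; simp [codewords, and_comm]
    have h4 : (codewords v true).filter Q =
        Finset.univ.filter fun x => Q x ∧ syndrome v x = 0 := by
      ext x; simp [codewords, and_comm]
    rw [Finset.filter_filter, h1] at h2
    rw [h3, h4, Nat.sub_one_mul]
    omega
  ext z
  rw [TamperDist, TamperDist, syndromeEnc, syndromeEnc, map_uniformOfFinset_apply,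
    map_uniformOfFinset_apply, hm, hcount _ fun i hi x => by rw [hf i hi]]
  have hall := hcount (fun _ => True) (by simp)
  simp only [Finset.filter_true] at hall
  rw [hall, Nat.cast_mul, Nat.cast_mul, ENNReal.mul_div_mul_left _ _ _ (by simp)]
  have : Fintype.card V - 1 ≠ 0 := by omega
  exact_mod_cast this

/-- If tampering preserves the contribution of at least half of the columns up to a shift, then
an encoding of `false` is rarely mapped to an encoding of `true`. -/
theorem TamperDist_false_apply {n : ℕ} {V : Type*} [AddCommGroup V] [Fintype V] [DecidableEq V]
    (hV : ∀ w : V, w + w = 0) (hcard : 2 ≤ Fintype.card V) (hn : Fintype.card V ≤ 2 * n)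
    (v : Fin n → V) (hv : Function.Injective v) (hv0 : ∀ i, v i ≠ 0)
    (hne : ∀ b, (codewords v b).Nonempty) (f : Word n → Word n) (T : Finset (Fin n))
    (hT : Fintype.card V ≤ 2 * T.card)
    (hf : ∀ i ∈ T, ∀ x, f (flipBit i x) = flipBit i (f x)) :
    1 - (TamperDist (syndromeEnc v hne) (syndromeDec v) f (fun _ => false)
      (some fun _ => false)).toReal ≤ 1 / (Fintype.card V - 1 : ℝ) := by
  have h1 := card_filter_eq_card_mul v hv hv0 T hT (fun _ => True) (fun x => syndrome v (f x))
    (by simp) fun i hi x => by rw [hf i hi, syndrome_flipBit hV]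
  have h2 := card_filter_eq_card_mul v hv hv0 Finset.univ (by simpa using hn) (fun _ => True)
    (syndrome v) (by simp) fun i _ x => syndrome_flipBit hV v i x
  simp only [true_and] at h1 h2
  have h3 := Finset.card_filter_add_card_filter_not (s := codewords v false)
    (fun x => syndrome v (f x) = 0)
  have h4 : ((codewords v false).filter fun x => syndrome v (f x) = 0).card ≤
      (Finset.univ.filter fun x => syndrome v (f x) = 0).card :=
    Finset.card_le_card (Finset.filter_subset_filter _ (Finset.subset_univ _))
  have h5 := Finset.card_filter_add_card_filter_not (s := (Finset.univ : Finset (Word n)))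
    (fun x => syndrome v x = 0)
  have h6 : codewords v false = Finset.univ.filter fun x => ¬ syndrome v x = 0 := by
    simp [codewords]
  have h7 : (Finset.univ.filter fun x => syndrome v (f x) = 0).card =
      (Finset.univ.filter fun x => syndrome v x = 0).card :=
    Nat.eq_of_mul_eq_mul_left (by omega) (h1.symm.trans h2)
  have hfilter : ((codewords v false).filter fun x => (syndromeDec v ∘ f) x = some fun _ => false) =
      (codewords v false).filter fun x => ¬ syndrome v (f x) = 0 := by
    refine Finset.filter_congr fun x _ => ?_
    simp [syndromeDec, funext_iff]
  have hpos := (hne false).card_pos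
  rw [TamperDist, syndromeEnc, map_uniformOfFinset_apply]
  change 1 - ((((codewords v false).filter fun x =>
    (syndromeDec v ∘ f) x = some fun _ => false).card : ENNReal) /
      (codewords v false).card).toReal ≤ _
  rw [hfilter, ENNReal.toReal_div, ENNReal.toReal_natCast, ENNReal.toReal_natCast]
  rw [h7] at h4
  rw [← h6] at h5
  simp only [Finset.filter_true] at h2
  rw [h2] at h5
  rify at h3 h4 h5 hpos hcard
  rw [one_sub_div hpos.ne', div_le_div_iff₀ hpos (by linarith)]
  nlinarith

/-- Non-malleability of the scheme based on a linear code whose parity-check columns are distinct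
nonzero vectors, all but at most one of the elements of an elementary abelian `2`-group. -/
theorem nonMalleable_syndromeEnc {n : ℕ} {V : Type*} [AddCommGroup V] [Fintype V] [DecidableEq V]
    (hV : ∀ w : V, w + w = 0) (hcard : 2 ≤ Fintype.card V) (heven : Even (Fintype.card V))
    (hn : n + 1 = Fintype.card V) (v : Fin n → V) (hv : Function.Injective v)
    (hv0 : ∀ i, v i ≠ 0) (hne : ∀ b, (codewords v b).Nonempty) :
    NonMalleable (syndromeEnc v hne) (syndromeDec v) (FBITfull n)
      (1 / (Fintype.card V - 1 : ℝ)) := by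
  rintro f ⟨g, hg⟩
  have hε : 0 ≤ 1 / (Fintype.card V - 1 : ℝ) := by
    have : (2 : ℝ) ≤ Fintype.card V := by exact_mod_cast hcard
    exact one_div_nonneg.2 (by linarith)
  have hsplit := Finset.card_filter_add_card_filter_not (s := (Finset.univ : Finset (Fin n)))
    (fun i => g i true = g i false)
  rw [Finset.card_univ, Fintype.card_fin] at hsplit
  have hf_const : ∀ i, g i true = g i false → ∀ x, f (flipBit i x) = f x := by
    intro i hi x
    funext j
    rw [hg, hg, flipBit]
    rcases eq_or_ne j i with rfl | hj
    · cases hx : x j <;> simp [hi]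
    · rw [Function.update_of_ne hj]
  have hf_inj : ∀ i, ¬ g i true = g i false → ∀ x, f (flipBit i x) = flipBit i (f x) := by
    intro i hi x
    funext j
    rcases eq_or_ne j i with rfl | hj
    · rw [hg]
      cases hx : x j <;> cases ht : g j true <;> cases hff : g j false <;>
        simp_all [flipBit]
    · simp [flipBit, hj, hg]
  obtain ⟨q, hq⟩ := heven
  rcases le_or_gt q (Finset.univ.filter fun i => g i true = g i false).card with hT | hT
  · refine ⟨(TamperDist (syndromeEnc v hne) (syndromeDec v) f fun _ => true).map
      fun o => o.elim (Sum.inr false) Sum.inl, fun m => ?_⟩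
    have hpatch : patchOut m ∘ (fun o : Option (Word 1) => o.elim (Sum.inr false) Sum.inl) = id := by
      funext o
      cases o <;> rfl
    rw [TamperDist_eq_of_hidden hV hcard v hv hv0 hne f _ (by omega)
      (fun i hi => hf_const i (Finset.mem_filter_univ i |>.1 hi)) m, PatchDist, PMF.map_comp,
      hpatch, PMF.map_id, SD_self]
    exact hε
  · refine ⟨(TamperDist (syndromeEnc v hne) (syndromeDec v) f fun _ => true).map
      fun o : Option (Word 1) => if o = some (fun _ => true) then
            Sum.inr true else Sum.inl fun _ => false,
      fun m => ?_⟩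
    rw [word_one_eq m]
    cases m 0
    · have hpatch : patchOut (fun _ : Fin 1 => false) ∘
          (fun o : Option (Word 1) => if o = some (fun _ => true) then
            Sum.inr true else Sum.inl fun _ => false) =
          Function.const _ (some fun _ => false) := by
        funext o
        simp only [Function.comp_apply, Function.const_apply]
        split_ifs <;> rfl
      rw [PatchDist, PMF.map_comp, hpatch, PMF.map_const, SD_pure]
      exact TamperDist_false_apply hV hcard (by omega) v hv hv0 hne f
        (Finset.univ.filter fun i => ¬ g i true = g i false) (by omega)
        fun i hi => hf_inj i (Finset.mem_filter_univ i |>.1 hi)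
    · have hpatch : (patchOut (fun _ : Fin 1 => true) ∘
          (fun o : Option (Word 1) => if o = some (fun _ => true) then
            Sum.inr true else Sum.inl fun _ => false)) ∘
          (fun c => syndromeDec v (f c)) = fun c => syndromeDec v (f c) := by
        funext c
        by_cases hc : syndrome v (f c) = 0 <;>
          simp [syndromeDec, hc, patchOut, funext_iff]
      rw [PatchDist, PMF.map_comp, TamperDist, PMF.map_comp, hpatch, SD_self]
      exact hε

/-- For every `δ > 0` and all large enough `h`, there is a `(k, 2^h − 1)`-coding
scheme with `k ≥ 1` that is non-malleable with respect to the bit-wise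
independent tampering family with exact security at most `δ` (obtained by
composing an AMD code with the coset-coding wiretap II code derived from the
binary Hamming code). -/
theorem explicit_bitwise_NMC (δ : ℝ) (hδ : 0 < δ) :
    ∃ h0 : ℕ, ∀ h : ℕ, h0 ≤ h →
      ∃ k : ℕ, 1 ≤ k ∧
        ∃ (Enc : Word k → PMF (Word (2 ^ h - 1)))
          (Dec : Word (2 ^ h - 1) → Option (Word k)),
            Correct Enc Dec ∧
            NonMalleable Enc Dec (FBITfull (2 ^ h - 1)) δ := by
  obtain ⟨N, hN⟩ := exists_nat_gt (1 / δ)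
  refine ⟨N + 1, fun h hh => ⟨1, le_rfl, ?_⟩⟩
  have hVcard : Fintype.card (Fin h → ZMod 2) = 2 ^ h := by simp [ZMod.card]
  have hpow : h < 2 ^ h := Nat.lt_two_pow_self
  have e : Fin (2 ^ h - 1) ≃ {w : Fin h → ZMod 2 // w ≠ 0} :=
    (Fintype.equivFinOfCardEq (by
      rw [Fintype.card_subtype_compl, Fintype.card_subtype_eq, hVcard])).symm
  have hv : Function.Injective fun i => (e i : Fin h → ZMod 2) :=
    Subtype.val_injective.comp e.injective
  have hv0 : ∀ i, (e i : Fin h → ZMod 2) ≠ 0 := fun i => (e i).2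
  have hne := codewords_nonempty (fun i => (e i : Fin h → ZMod 2)) hv0 (by omega)
  refine ⟨_, _, correct_syndromeEnc _ hne, fun f hf => ?_⟩
  obtain ⟨D, hD⟩ := nonMalleable_syndromeEnc (fun w => funext fun i => CharTwo.add_self_eq_zero (w i))
    (by omega) (by rw [hVcard]; exact Nat.even_pow.2 ⟨even_two, by omega⟩) (by omega) _ hv hv0 hne
    f hf
  refine ⟨D, fun m => (hD m).trans ?_⟩
  have hlarge : (N : ℝ) ≤ Fintype.card (Fin h → ZMod 2) - 1 := by
    have : N + 1 ≤ Fintype.card (Fin h → ZMod 2) := by omega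
    rify at this
    linarith
  rw [one_div_le (lt_trans (one_div_pos.2 hδ) (hN.trans_le hlarge)) hδ]
  exact (hN.trans_le hlarge).le
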